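/- Let G be a finite simple graph and let k be a positive integer with k ≥ Δ(G) + 1, where Δ(G) is the maximum degree of G. Then G has an equitable k-coloring, i.e., a proper vertex coloring with k colors in which the sizes of any two color classes differ by at most 1. -/

import Mathlib

namespace HajnalSzemeredi

open Finset Relation
open scoped Classical

universe u v

section Reachability

variable {α : Type*}

/-- A vertex reaching `a ≠ x` from `x` can be assumed to leave `x` once and for all. -/
lemma exists_step_avoiding {R : α → α → Prop} {x a : α} (hxa : x ≠ a)
    (h : ReflTransGen R x a) :
    ∃ y, y ≠ x ∧ R x y ∧ ReflTransGen (fun i j => R i j ∧ i ≠ x ∧ j ≠ x) y a := by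
  have key : ∀ y, ReflTransGen R y a →
      (y ≠ x ∧ ReflTransGen (fun i j => R i j ∧ i ≠ x ∧ j ≠ x) y a) ∨
      ∃ y, y ≠ x ∧ R x y ∧ ReflTransGen (fun i j => R i j ∧ i ≠ x ∧ j ≠ x) y a := by
    intro y hy
    induction hy using ReflTransGen.head_induction_on with
    | refl => exact Or.inl ⟨hxa.symm, .refl⟩
    | head hstep _ ih =>
      rename_i y y' _
      rcases ih with ⟨hne, hr⟩ | h
      · by_cases hyx : y = x
        · subst hyx
          exact Or.inr ⟨y', hne, hstep, hr⟩
        · exact Or.inl ⟨hyx, .head ⟨hstep, hyx, hne⟩ hr⟩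
      · exact Or.inr h
  rcases key x h with ⟨h, _⟩ | h
  · exact absurd rfl h
  · exact h

/-- In a finite digraph where some vertex other than `a` reaches `a`, there are a vertex `U` and a
nonempty set `T` of vertices such that no vertex of `T` is needed by other vertices to reach `a`,
and, among the vertices that reach `a`, the out-neighbours of `T` lie in `T ∪ {U}`. -/
lemma exists_terminal_family [Fintype α] (R : α → α → Prop) (a : α)
    (h : ∃ x, x ≠ a ∧ ReflTransGen R x a) :
    ∃ (U : α) (T : Finset α), T.Nonempty ∧ a ∉ T ∧ U ∉ T ∧ ReflTransGen R U a ∧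
      (∀ W ∈ T, ReflTransGen R W a) ∧
      (∀ W ∈ T, ∀ X, ReflTransGen R X a → X ≠ W →
        ReflTransGen (fun i j => R i j ∧ i ≠ W ∧ j ≠ W) X a) ∧
      (∀ W ∈ T, ∀ X, R W X → ReflTransGen R X a → X ∈ T ∨ X = U) := by
  set avoid : α → α → Prop := fun W X => ReflTransGen (fun i j => R i j ∧ i ≠ W ∧ j ≠ W) X a
    with havoid
  set T : α → Finset α := fun U => univ.filter fun X => X ≠ U ∧ ReflTransGen R X a ∧ ¬ avoid U X
    with hT
  have memT : ∀ U X, X ∈ T U ↔ X ≠ U ∧ ReflTransGen R X a ∧ ¬ avoid U X := by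
    intro U X; simp [hT]
  have hne : (univ.filter fun U => ReflTransGen R U a ∧ (T U).Nonempty).Nonempty := by
    obtain ⟨x, hx, hxa⟩ := h
    refine ⟨a, ?_⟩
    simp only [mem_filter, mem_univ, true_and]
    refine ⟨.refl, x, (memT _ _).2 ⟨hx, hxa, fun h => ?_⟩⟩
    rcases ReflTransGen.cases_tail h with h | ⟨_, _, h⟩
    · exact hx h.symm
    · exact h.2.2 rfl
  obtain ⟨U, hU, hmin⟩ := exists_min_image _ (fun U => (T U).card) hne
  simp only [mem_filter, mem_univ, true_and] at hU hmin
  obtain ⟨hUa, hUne⟩ := hU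
  refine ⟨U, T U, hUne, ?_, ?_, hUa, ?_, ?_, ?_⟩
  · intro h
    exact ((memT _ _).1 h).2.2 .refl
  · intro h
    exact ((memT _ _).1 h).1 rfl
  · intro W h
    exact ((memT _ _).1 h).2.1
  · intro W hW X hX hXW
    by_contra hcon
    obtain ⟨hWU, hWa, hWav⟩ := (memT _ _).1 hW
    have h1 : ∀ Y, avoid U Y → avoid W Y := by
      intro Y hY
      induction hY using ReflTransGen.head_induction_on with
      | refl => exact .refl
      | head hstep hrest ih =>
        refine .head ⟨hstep.1, ?_, ?_⟩ ih
        · rintro rfl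
          exact hWav (.head hstep hrest)
        · rintro rfl
          exact hWav hrest
    have h2 : avoid W U := by
      by_cases hUeq : U = a
      · rw [hUeq]
      · obtain ⟨y, hy, hRy, hya⟩ := exists_step_avoiding hUeq hUa
        refine .head ⟨hRy, hWU.symm, ?_⟩ (h1 y hya)
        rintro rfl
        exact hWav hya
    have hss : T W ⊂ T U := by
      refine (ssubset_iff_of_subset ?_).2 ⟨W, hW, fun h => ((memT _ _).1 h).1 rfl⟩
      intro Y hY
      obtain ⟨_, hYa, hYav⟩ := (memT _ _).1 hY
      refine (memT _ _).2 ⟨?_, hYa, fun h => hYav (h1 Y h)⟩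
      rintro rfl
      exact hYav h2
    exact absurd (card_lt_card hss)
      (not_lt.2 (hmin W ⟨hWa, X, (memT _ _).2 ⟨hXW, hX, hcon⟩⟩))
  · intro W hW X hR hX
    obtain ⟨hWU, _, hWav⟩ := (memT _ _).1 hW
    by_contra! hcon
    have : avoid U X := by
      by_contra h
      exact hcon.1 ((memT _ _).2 ⟨hcon.2, hX, h⟩)
    exact hWav (.head ⟨hR, hWU, hcon.2⟩ this)

/-- A path avoiding `W` and ending at `a` stays among the vertices that reach `a`. -/
lemma reflTransGen_avoid_mem {R : α → α → Prop} {a W : α} {A : Finset α}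
    (memA : ∀ i, i ∈ A ↔ ReflTransGen R i a) {x : α}
    (h : ReflTransGen (fun i j => R i j ∧ i ≠ W ∧ j ≠ W) x a) :
    ReflTransGen (fun i j => R i j ∧ i ∈ A.erase W ∧ j ∈ A.erase W) x a := by
  induction h using ReflTransGen.head_induction_on with
  | refl => exact .refl
  | head hstep hrest ih =>
    have h1 := ReflTransGen.mono (fun _ _ h => h.1) _ _ hrest
    exact .head ⟨hstep.1, mem_erase.2 ⟨hstep.2.1, (memA _).2 (.head hstep.1 h1)⟩,
      mem_erase.2 ⟨hstep.2.2, (memA _).2 h1⟩⟩ ih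

end Reachability

section Colorings

variable {V : Type u} {ι : Type v} (G : SimpleGraph V) (c : V → ι)

/-- Adjacent vertices receive different colors. -/
def Proper : Prop := ∀ x y, G.Adj x y → c x ≠ c y

/-- The vertex `x` has no neighbour of color `j`. -/
def Movable (x : V) (j : ι) : Prop := ∀ y, c y = j → ¬ G.Adj x y

/-- Some vertex of color `i` has no neighbour of color `j`. -/
def Moves (i j : ι) : Prop := ∃ x, c x = i ∧ Movable G c x j

/-- The vertex `z` is the only neighbour of `y` having the color of `z`. -/
def Solo (z y : V) : Prop := G.Adj y z ∧ ∀ w, c w = c z → G.Adj y w → w = z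

variable {G c} in
lemma not_movable_iff {x : V} {j : ι} : ¬ Movable G c x j ↔ ∃ y, c y = j ∧ G.Adj x y := by
  simp [Movable]

variable {G c} in
lemma Proper.update (hc : Proper G c) {x : V} {j : ι} (h : Movable G c x j) :
    Proper G (Function.update c x j) := by
  intro y z hyz
  by_cases hy : y = x
  · subst hy
    rw [Function.update_self, Function.update_of_ne hyz.ne']
    exact fun he => h z he.symm hyz
  · by_cases hz : z = x
    · subst hz
      rw [Function.update_self, Function.update_of_ne hyz.ne]
      exact fun he => h y he hyz.symm
    · rw [Function.update_of_ne hy, Function.update_of_ne hz]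
      exact hc y z hyz

variable {G c} in
/-- After an exchange along a solo edge `zy₁` in a terminal class, with `z` sent outside `A`, every
accessible class stays accessible, and so becomes the class of another solo neighbour of `z`. -/
lemma accessible_of_exchange {d g : V → ι} {A : Finset ι} {a : ι} {z y₁ y₂ : V} {X : ι}
    (memA : ∀ i, i ∈ A ↔ ReflTransGen (Moves G c) i a)
    (hz : c z ∈ A) (hza : c z ≠ a) (hX : X ∉ A)
    (hzy : Solo G c z y₂) (hadj : ¬ G.Adj y₁ y₂)
    (hterm : ∀ i ∈ A, i ≠ c z →
      ReflTransGen (fun i j => Moves G c i j ∧ i ≠ c z ∧ j ≠ c z) i a)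
    (hzmov : ∀ j ∈ A, j ≠ c z → ¬ Movable G c z j)
    (hgA : ∀ v, c v ∉ A → v ≠ y₁ → g v ∉ A)
    (hdz : d z = X) (hdy : d y₁ = c z)
    (hdA : ∀ v, v ≠ z → c v ∈ A → d v = c v) (hdB : ∀ v, v ≠ y₁ → c v ∉ A → d v = g v) :
    (∀ i ∈ A, ReflTransGen (Moves G d) i a) ∧ ReflTransGen (Moves G d) (d y₂) a := by
  have hclass : ∀ v, d v ∈ A → v ≠ y₁ → v ≠ z ∧ c v = d v := by
    intro v hv hvy
    have hvz : v ≠ z := by rintro rfl; exact hX (hdz ▸ hv)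
    refine ⟨hvz, ?_⟩
    by_cases hvA : c v ∈ A
    · exact (hdA v hvz hvA).symm
    · rw [hdB v hvy hvA] at hv
      exact absurd hv (hgA v hvA hvy)
  have hmov : ∀ v, ∀ j ∈ A, j ≠ c z → Movable G c v j → Movable G d v j := by
    intro v j hj hjz hv w hw
    have hwy : w ≠ y₁ := by rintro rfl; exact hjz (hw.symm.trans hdy)
    exact hv w ((hclass w (hw ▸ hj) hwy).2.trans hw)
  have hother : ∀ i ∈ A, i ≠ c z → ReflTransGen (Moves G d) i a := by
    intro i hi hiz
    refine ReflTransGen.mono ?_ _ _ (reflTransGen_avoid_mem memA (hterm i hi hiz))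
    rintro i j ⟨⟨v, rfl, hv⟩, hi, hj⟩
    rw [mem_erase] at hi hj
    have hvz : v ≠ z := by rintro rfl; exact hi.1 rfl
    exact ⟨v, hdA v hvz hi.2, hmov v j hj.2 hj.1 hv⟩
  have hW : ReflTransGen (Moves G d) (c z) a := by
    obtain ⟨j, hjz, ⟨v, hv, hvj⟩, hj⟩ := exists_step_avoiding hza ((memA _).1 hz)
    have hjA : j ∈ A := (memA _).2 (ReflTransGen.mono (fun _ _ h => h.1) _ _ hj)
    have hvz : v ≠ z := by rintro rfl; exact hzmov j hjA hjz hvj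
    exact .head ⟨v, (hdA v hvz (hv ▸ hz)).trans hv, hmov v j hjA hjz hvj⟩ (hother j hjA hjz)
  refine ⟨fun i hi => ?_, .head ⟨y₂, rfl, fun w hw hyw => ?_⟩ hW⟩
  · by_cases hiz : i = c z
    · rw [hiz]; exact hW
    · exact hother i hi hiz
  · have hwy : w ≠ y₁ := by rintro rfl; exact hadj hyw.symm
    obtain ⟨hwz, hcw⟩ := hclass w (hw ▸ hz) hwy
    exact hwz (hzy.2 w (hcw.trans hw) hyw)

variable [Fintype V]

/-- The vertices whose color lies in `K`. -/
noncomputable def fiber (K : Finset ι) : Finset V := univ.filter fun x => c x ∈ K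

/-- The neighbours of `x` whose color lies in `K`. -/
noncomputable def nbr (x : V) (K : Finset ι) : Finset V :=
  univ.filter fun y => G.Adj x y ∧ c y ∈ K

variable {G c}

lemma mem_fiber {K : Finset ι} {x : V} : x ∈ fiber c K ↔ c x ∈ K := by simp [fiber]

lemma mem_nbr {K : Finset ι} {x y : V} : y ∈ nbr G c x K ↔ G.Adj x y ∧ c y ∈ K := by
  simp [nbr]

lemma card_fiber_eq_sum (K : Finset ι) : (fiber c K).card = ∑ j ∈ K, (fiber c {j}).card := by
  rw [card_eq_sum_card_fiberwise (f := c) (t := K) fun x hx => mem_fiber.1 hx]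
  refine sum_congr rfl fun j hj => congrArg card ?_
  ext x
  simp only [mem_filter, mem_fiber, mem_singleton]
  exact ⟨fun h => h.2, fun h => ⟨h ▸ hj, h⟩⟩

lemma card_nbr_eq_sum (x : V) (K : Finset ι) :
    (nbr G c x K).card = ∑ j ∈ K, (nbr G c x {j}).card := by
  rw [card_eq_sum_card_fiberwise (f := c) (t := K) fun x hx => (mem_nbr.1 hx).2]
  refine sum_congr rfl fun j hj => congrArg card ?_
  ext x
  simp only [mem_filter, mem_nbr, mem_singleton]
  exact ⟨fun h => ⟨h.1.1, h.2⟩, fun h => ⟨⟨h.1, h.2 ▸ hj⟩, h.2⟩⟩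

lemma card_nbr_mono (x : V) {K L : Finset ι} (h : K ⊆ L) :
    (nbr G c x K).card ≤ (nbr G c x L).card :=
  card_le_card fun _ hy => mem_nbr.2 ⟨(mem_nbr.1 hy).1, h (mem_nbr.1 hy).2⟩

lemma card_le_card_nbr {x : V} {K : Finset ι} (h : ∀ j ∈ K, ¬ Movable G c x j) :
    K.card ≤ (nbr G c x K).card := by
  rw [card_nbr_eq_sum, card_eq_sum_ones]
  refine sum_le_sum fun j hj => ?_
  obtain ⟨y, hy, hxy⟩ := not_movable_iff.1 (h j hj)
  exact card_pos.2 ⟨y, mem_nbr.2 ⟨hxy, by simp [hy]⟩⟩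

lemma card_fiber_update (x : V) (j i : ι) :
    (fiber (Function.update c x j) {i}).card + (if i = c x then 1 else 0) =
      (fiber c {i}).card + (if i = j then 1 else 0) := by
  have h : ∀ d : V → ι, (fiber d {i}).card =
      ((univ.erase x).filter fun y => d y = i).card + (if i = d x then 1 else 0) := by
    intro d
    have : fiber d {i} = (insert x (univ.erase x)).filter fun y => d y = i := by
      ext y; simp [mem_fiber]
    rw [this, filter_insert]
    by_cases hi : d x = i
    · rw [if_pos hi, if_pos hi.symm, card_insert_of_notMem (by simp)]
    · rw [if_neg hi, if_neg (Ne.symm hi), add_zero]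
  have h2 : ((univ.erase x).filter fun y => Function.update c x j y = i) =
      (univ.erase x).filter fun y => c y = i := by
    refine filter_congr fun y hy => ?_
    rw [Function.update_of_ne (ne_of_mem_erase hy)]
  rw [h, h c, h2, Function.update_self]
  omega

/-- Moving one vertex along each edge of a path from `x` to `a` transfers one unit of size from
the class of `x` to the class of `a`, using only classes from `P`. -/
lemma exists_shift (hc : Proper G c) (a : ι) (P : Finset ι) : ∀ x ∈ P,
    ReflTransGen (fun i j => Moves G c i j ∧ i ∈ P ∧ j ∈ P) x a →
    ∃ d : V → ι, Proper G d ∧ (∀ y, c y ∉ P → d y = c y) ∧ (∀ y, c y ∈ P → d y ∈ P) ∧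
      (∀ y, d y = x → c y = x) ∧
      ∀ i, (fiber d {i}).card + (if i = x then 1 else 0) =
        (fiber c {i}).card + (if i = a then 1 else 0) := by
  induction P using Finset.strongInduction with
  | H P ih =>
    intro x hxP hx
    by_cases hxa : x = a
    · subst hxa
      exact ⟨c, hc, fun _ _ => rfl, fun _ h => h, fun _ h => h, fun _ => rfl⟩
    · obtain ⟨x', hne, ⟨⟨v, hv, hmv⟩, -, hx'P⟩, hr⟩ := exists_step_avoiding hxa hx
      obtain ⟨d, hd, hout, hin, hsub, hcard⟩ := ih (P.erase x) (erase_ssubset hxP) x'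
        (mem_erase.2 ⟨hne, hx'P⟩) (ReflTransGen.mono (fun i j h =>
          ⟨h.1.1, mem_erase.2 ⟨h.2.1, h.1.2.1⟩, mem_erase.2 ⟨h.2.2, h.1.2.2⟩⟩) _ _ hr)
      have hdx : ∀ y, c y = x → d y = x := fun y hy => by
        rw [hout y (by simp [hy]), hy]
      have hdx' : ∀ y, d y = x → c y = x := fun y hy => by
        by_contra hcy
        by_cases hP : c y ∈ P
        · have := hin y (mem_erase.2 ⟨hcy, hP⟩)
          rw [hy] at this
          exact absurd rfl (mem_erase.1 this).1
        · rw [hout y fun h => hP (mem_erase.1 h).2] at hy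
          exact hcy hy
      refine ⟨Function.update d v x', hd.update fun y hy => hmv y (hsub y hy), ?_, ?_, ?_, ?_⟩
      · intro y hy
        rw [Function.update_of_ne, hout y fun h => hy (mem_erase.1 h).2]
        rintro rfl
        exact hy (hv ▸ hxP)
      · intro y hy
        by_cases hyv : y = v
        · rw [hyv, Function.update_self]; exact hx'P
        · rw [Function.update_of_ne hyv]
          by_cases hyx : c y = x
          · rw [hdx y hyx]; exact hxP
          · exact (mem_erase.1 (hin y (mem_erase.2 ⟨hyx, hy⟩))).2
      · intro y hy
        by_cases hyv : y = v
        · rw [hyv]; exact hv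
        · rw [Function.update_of_ne hyv] at hy
          exact hdx' y hy
      · intro i
        have h1 := card_fiber_update (c := d) v x' i
        rw [hdx v hv] at h1
        rw [h1, hcard]

/-- Move `z` to the class `X` and its solo neighbour `y` to the class of `z`, and recolor the other
vertices with colors outside `A` by `g`. -/
lemma exists_exchange (hc : Proper G c) {s : ℕ} {A : Finset ι} {z y : V} {X : ι} {g : V → ι}
    (hz : c z ∈ A) (hy : c y ∉ A) (hzy : Solo G c z y) (hX : X ≠ c z)
    (hgA : ∀ v, c v ∉ A → v ≠ y → g v ∉ A)
    (hg : ∀ u v, c u ∉ A → u ≠ y → c v ∉ A → v ≠ y → G.Adj u v → g u ≠ g v)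
    (hgs : ∀ i, i ∉ A → (univ.filter fun v => c v ∉ A ∧ v ≠ y ∧ g v = i).card = s)
    (hzA : ∀ v, c v ∈ A → c v = X → ¬ G.Adj z v)
    (hzB : ∀ v, c v ∉ A → v ≠ y → g v = X → ¬ G.Adj z v) :
    ∃ d : V → ι, Proper G d ∧ d z = X ∧ d y = c z ∧
      (∀ v, v ≠ z → c v ∈ A → d v = c v) ∧ (∀ v, v ≠ y → c v ∉ A → d v = g v) ∧
      (∀ i ∈ A, (fiber d {i}).card = (fiber c {i}).card + (if i = X then 1 else 0)) ∧
      (∀ i, i ∉ A → (fiber d {i}).card = s + (if i = X then 1 else 0)) := by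
  have hne : z ≠ y := by rintro rfl; exact hy hz
  set e : V → ι := fun v => if c v ∈ A ∨ v = y then c v else g v with he
  set d := Function.update (Function.update e z X) y (c z) with hd
  have ez : e z = c z := by simp [he, hz]
  have ey : e y = c y := by simp [he]
  have hdz : d z = X := by rw [hd, Function.update_of_ne hne, Function.update_self]
  have hdy : d y = c z := by rw [hd, Function.update_self]
  have hdA : ∀ v, v ≠ z → c v ∈ A → d v = c v := by
    intro v hv hvA
    have hvy : v ≠ y := by rintro rfl; exact hy hvA
    rw [hd, Function.update_of_ne hvy, Function.update_of_ne hv]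
    simp [he, hvA]
  have hdB : ∀ v, v ≠ y → c v ∉ A → d v = g v := by
    intro v hv hvA
    have hvz : v ≠ z := by rintro rfl; exact hvA hz
    rw [hd, Function.update_of_ne hv, Function.update_of_ne hvz]
    simp [he, hvA, hv]
  have hcount : ∀ i, (fiber d {i}).card + (if i = c y then 1 else 0) =
      (fiber e {i}).card + (if i = X then 1 else 0) := by
    intro i
    have h1 := card_fiber_update (c := e) z X i
    have h2 := card_fiber_update (c := Function.update e z X) y (c z) i
    rw [Function.update_of_ne hne.symm, ey] at h2
    rw [ez] at h1
    rw [hd]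
    omega
  refine ⟨d, ?_, hdz, hdy, hdA, hdB, ?_, ?_⟩
  · have hzv : ∀ v, G.Adj z v → d v ≠ X := by
      intro v hv hvX
      by_cases hvy : v = y
      · rw [hvy, hdy] at hvX; exact hX hvX.symm
      · by_cases hvA : c v ∈ A
        · rw [hdA v hv.ne' hvA] at hvX; exact hzA v hvA hvX hv
        · rw [hdB v hvy hvA] at hvX; exact hzB v hvA hvy hvX hv
    have hyv : ∀ v, G.Adj y v → d v ≠ c z := by
      intro v hv hvX
      by_cases hvz : v = z
      · rw [hvz, hdz] at hvX; exact hX hvX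
      · by_cases hvA : c v ∈ A
        · rw [hdA v hvz hvA] at hvX; exact hvz (hzy.2 v hvX hv)
        · rw [hdB v hv.ne' hvA] at hvX
          exact hgA v hvA hv.ne' (hvX ▸ hz)
    intro u v huv
    by_cases h1 : u = z
    · rw [h1, hdz]; exact (hzv v (h1 ▸ huv)).symm
    by_cases h2 : u = y
    · rw [h2, hdy]; exact (hyv v (h2 ▸ huv)).symm
    by_cases h3 : v = z
    · rw [h3, hdz]; exact hzv u (h3 ▸ huv.symm)
    by_cases h4 : v = y
    · rw [h4, hdy]; exact hyv u (h4 ▸ huv.symm)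
    by_cases hu : c u ∈ A <;> by_cases hv : c v ∈ A
    · rw [hdA u h1 hu, hdA v h3 hv]; exact hc u v huv
    · rw [hdA u h1 hu, hdB v h4 hv]
      exact fun h => hgA v hv h4 (h ▸ hu)
    · rw [hdB u h2 hu, hdA v h3 hv]
      exact fun h => hgA u hu h2 (h ▸ hv)
    · rw [hdB u h2 hu, hdB v h4 hv]; exact hg u v hu h2 hv h4 huv
  · intro i hi
    have h1 := hcount i
    have h2 : fiber e {i} = fiber c {i} := by
      ext v
      simp only [mem_fiber, mem_singleton, he]
      by_cases hv : c v ∈ A ∨ v = y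
      · rw [if_pos hv]
      · rw [if_neg hv]
        push Not at hv
        exact ⟨fun h => absurd (h ▸ hi) (hgA v hv.1 hv.2), fun h => absurd (h ▸ hi) hv.1⟩
    rw [if_neg (fun h : i = c y => hy (h ▸ hi)), h2] at h1
    exact h1
  · intro i hi
    have h1 := hcount i
    have h2 : (fiber e {i}).card = s + (if i = c y then 1 else 0) := by
      rw [← hgs i hi]
      by_cases hiy : i = c y
      · rw [if_pos hiy, ← card_insert_of_notMem (a := y) (by simp)]
        congr 1
        ext v
        simp only [mem_fiber, mem_singleton, he, mem_insert, mem_filter, mem_univ, true_and]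
        by_cases hv : v = y
        · simp [hv, hiy]
        · by_cases hvA : c v ∈ A
          · simp only [hvA, if_true, hv, not_true, false_and, or_false, iff_false]
            exact fun h => hi (h ▸ hvA)
          · simp [hv, hvA]
      · rw [if_neg hiy, add_zero]
        congr 1
        ext v
        simp only [mem_fiber, mem_singleton, he, mem_filter, mem_univ, true_and]
        by_cases hv : v = y
        · simp [hv, Ne.symm hiy]
        · by_cases hvA : c v ∈ A
          · simp only [hvA, true_or, if_true, not_true, false_and, iff_false]
            exact fun h => hi (h ▸ hvA)
          · simp [hv, hvA]
    omega

variable [Fintype ι]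

lemma card_nbr_add_compl (x : V) (K : Finset ι) :
    (nbr G c x K).card + (nbr G c x Kᶜ).card = (univ.filter (G.Adj x)).card := by
  rw [← card_union_of_disjoint]
  · congr 1
    ext y
    simp only [mem_union, mem_nbr, mem_compl, mem_filter, mem_univ, true_and]
    tauto
  · rw [Finset.disjoint_left]
    intro y h1 h2
    exact (mem_compl.1 (mem_nbr.1 h2).2) (mem_nbr.1 h1).2

/-- A vertex with a neighbour in every class of `A` has few neighbours outside `A`. -/
lemma card_nbr_compl_lt (hdeg : ∀ x, (univ.filter (G.Adj x)).card < Fintype.card ι)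
    {A S : Finset ι} (hSA : S ⊆ A) {x : V} (h : ∀ j ∈ S, ¬ Movable G c x j) :
    S.card + (nbr G c x Aᶜ).card < A.card + Aᶜ.card := by
  have h1 := card_nbr_add_compl (G := G) (c := c) x A
  have h2 := card_le_card_nbr h
  have h3 := card_nbr_mono (G := G) (c := c) x hSA
  have h4 := hdeg x
  have h5 := card_add_card_compl A
  omega

/-- The number of solo neighbours of a vertex outside `A` is large. -/
lemma card_solo_ge (hdeg : ∀ x, (univ.filter (G.Adj x)).card < Fintype.card ι)
    {A T : Finset ι} (hTA : T ⊆ A) {y : V} (h : ∀ j ∈ A, ¬ Movable G c y j) :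
    T.card + (nbr G c y Aᶜ).card + 1 ≤
      ((fiber c T).filter fun z => Solo G c z y).card + Aᶜ.card := by
  have h1 := card_nbr_add_compl (G := G) (c := c) y A
  have h4 := hdeg y
  have h5 := card_add_card_compl A
  have hpos : ∀ j ∈ A, 1 ≤ (nbr G c y {j}).card := fun j hj => by
    obtain ⟨z, hz, hyz⟩ := not_movable_iff.1 (h j hj)
    exact card_pos.2 ⟨z, mem_nbr.2 ⟨hyz, by simp [hz]⟩⟩
  have hsolo : ((fiber c T).filter fun z => Solo G c z y).card =
      ∑ j ∈ T, ((fiber c {j}).filter fun z => Solo G c z y).card := by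
    rw [card_eq_sum_card_fiberwise (f := c) (t := T)
      fun x hx => mem_fiber.1 (mem_filter.1 hx).1]
    refine sum_congr rfl fun j hj => congrArg card ?_
    ext x
    simp only [mem_filter, mem_fiber, mem_singleton]
    exact ⟨fun h => ⟨h.2, h.1.2⟩, fun h => ⟨⟨h.1 ▸ hj, h.2⟩, h.1⟩⟩
  have htwo : ∀ j ∈ T, 2 ≤ (nbr G c y {j}).card +
      ((fiber c {j}).filter fun z => Solo G c z y).card := by
    intro j hj
    by_contra! hlt
    have h1 := hpos j (hTA hj)
    obtain ⟨z, hz⟩ := card_eq_one.1 (show (nbr G c y {j}).card = 1 by omega)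
    have hzm : z ∈ nbr G c y {j} := by rw [hz]; exact mem_singleton_self z
    obtain ⟨hyz, hcz⟩ := mem_nbr.1 hzm
    have : 0 < ((fiber c {j}).filter fun z => Solo G c z y).card := by
      refine card_pos.2 ⟨z, mem_filter.2 ⟨mem_fiber.2 hcz, hyz, fun w hw hyw => ?_⟩⟩
      have : w ∈ nbr G c y {j} := mem_nbr.2 ⟨hyw, hw ▸ hcz⟩
      rw [hz] at this
      exact mem_singleton.1 this
    omega
  have hsum : A.card + T.card ≤ (nbr G c y A).card +
      ((fiber c T).filter fun z => Solo G c z y).card := by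
    rw [hsolo, card_nbr_eq_sum, ← sum_sdiff hTA, ← card_sdiff_add_card_eq_card hTA, add_assoc,
      add_assoc, ← sum_add_distrib]
    refine add_le_add ?_ ?_
    · rw [card_eq_sum_ones]
      exact sum_le_sum fun j hj => hpos j (mem_sdiff.1 hj).1
    · rw [← two_mul, mul_comm, ← smul_eq_mul, ← sum_const]
      exact sum_le_sum htwo
  omega

/-- If no solo vertex of the class `W` can be moved inside `A`, then `A` has more classes in the
terminal family `T` than there are classes outside `A`. -/
lemma card_compl_lt_card_terminal
    (hdeg : ∀ x, (univ.filter (G.Adj x)).card < Fintype.card ι) {s : ℕ} {A T : Finset ι} {U W : ι}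
    (hTA : T ⊆ A) (hU : U ∈ A) (hUT : U ∉ T) (hWT : W ∈ T) (hW : (fiber c {W}).card = s)
    (hB : (fiber c Aᶜ).card = Aᶜ.card * s + 1)
    (hA : ∀ y, c y ∉ A → ∀ j ∈ A, ¬ Movable G c y j)
    (hT : ∀ x, c x ∈ T → ∀ j ∈ A, j ∉ T → j ≠ U → ¬ Movable G c x j)
    (hsolo : ∀ z y, c z ∈ T → c y ∉ A → Solo G c z y → ∀ j ∈ A, j ≠ c z → ¬ Movable G c z j) :
    Aᶜ.card < T.card := by
  by_contra! hle
  set B := fiber c Aᶜ with hBdef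
  have memB : ∀ y, y ∈ B ↔ c y ∉ A := fun y => by rw [hBdef, mem_fiber, mem_compl]
  have memW : ∀ z, z ∈ fiber c {W} ↔ c z = W := fun z => by rw [mem_fiber, mem_singleton]
  set wt : V → ℕ := fun z => if ∃ y ∈ B, Solo G c z y then 2 else 1 with hwt
  have hwt1 : ∀ z, 1 ≤ wt z := fun z => by simp only [hwt]; split_ifs <;> omega
  have hlow : ∀ y ∈ B, 2 ≤ ∑ z ∈ fiber c {W}, if G.Adj y z then wt z else 0 := by
    intro y hy
    obtain ⟨z, hz, hyz⟩ := not_movable_iff.1 (hA y ((memB y).1 hy) W (hTA hWT))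
    by_cases hzs : Solo G c z y
    · calc 2 = if G.Adj y z then wt z else 0 := by
            rw [if_pos hyz]; simp only [hwt]; rw [if_pos ⟨y, hy, hzs⟩]
        _ ≤ _ := single_le_sum (f := fun z => if G.Adj y z then wt z else 0)
            (fun _ _ => Nat.zero_le _) ((memW z).2 hz)
    · obtain ⟨z', hz', hyz', hne⟩ : ∃ w, c w = c z ∧ G.Adj y w ∧ w ≠ z := by
        by_contra! h
        exact hzs ⟨hyz, h⟩
      calc 2 ≤ ∑ x ∈ {z', z}, if G.Adj y x then wt x else 0 := by
            rw [sum_pair hne, if_pos hyz, if_pos hyz']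
            have := hwt1 z; have := hwt1 z'; omega
        _ ≤ _ := by
            refine sum_le_sum_of_subset fun x hx => ?_
            rcases mem_insert.1 hx with rfl | hx
            · exact (memW _).2 (hz'.trans hz)
            · rw [mem_singleton.1 hx]; exact (memW z).2 hz
  have hup : ∀ z ∈ fiber c {W}, (∑ y ∈ B, if G.Adj y z then wt z else 0) ≤ 2 * Aᶜ.card := by
    intro z hz
    have hzW := (memW z).1 hz
    have hzT : c z ∈ T := hzW ▸ hWT
    have heq : (∑ y ∈ B, if G.Adj y z then wt z else 0) = (nbr G c z Aᶜ).card * wt z := by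
      rw [← sum_filter, sum_const, smul_eq_mul]
      congr 2
      ext y
      simp only [mem_filter, mem_nbr, memB, mem_compl, G.adj_comm z y]
      tauto
    rw [heq]
    simp only [hwt]
    split_ifs with hs
    · obtain ⟨y, hy, hzy⟩ := hs
      have := card_nbr_compl_lt (c := c) hdeg (erase_subset (c z) A) (x := z) fun j hj =>
        hsolo z y hzT ((memB y).1 hy) hzy j (mem_erase.1 hj).2 (mem_erase.1 hj).1
      have := card_erase_add_one (hTA hzT)
      omega
    · have := card_nbr_compl_lt (c := c) (S := (A \ T).erase U) hdeg
        ((erase_subset _ _).trans sdiff_subset) (x := z) fun j hj => by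
          obtain ⟨h1, h2⟩ := mem_erase.1 hj
          exact hT z hzT j (mem_sdiff.1 h2).1 (mem_sdiff.1 h2).2 h1
      have h1 := card_erase_add_one (mem_sdiff.2 ⟨hU, hUT⟩)
      have h2 := card_sdiff_add_card_eq_card hTA
      omega
  have h1 : B.card * 2 ≤ ∑ y ∈ B, ∑ z ∈ fiber c {W}, if G.Adj y z then wt z else 0 := by
    rw [← smul_eq_mul, ← sum_const]
    exact sum_le_sum hlow
  rw [sum_comm] at h1
  have h2 := sum_le_sum hup
  rw [sum_const, hW, smul_eq_mul] at h2
  rw [hB] at h1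
  nlinarith

/-- If no solo vertex of the terminal family `T` can be moved inside `A`, then some solo vertex has
two nonadjacent solo neighbours outside `A`. -/
lemma exists_solo_pair
    (hdeg : ∀ x, (univ.filter (G.Adj x)).card < Fintype.card ι) {s : ℕ} {A T : Finset ι} {U : ι}
    (hTA : T ⊆ A) (hU : U ∈ A) (hUT : U ∉ T) (hTne : T.Nonempty)
    (hTs : ∀ W ∈ T, (fiber c {W}).card = s)
    (hB : (fiber c Aᶜ).card = Aᶜ.card * s + 1)
    (hA : ∀ y, c y ∉ A → ∀ j ∈ A, ¬ Movable G c y j)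
    (hT : ∀ x, c x ∈ T → ∀ j ∈ A, j ∉ T → j ≠ U → ¬ Movable G c x j)
    (hsolo : ∀ z y, c z ∈ T → c y ∉ A → Solo G c z y → ∀ j ∈ A, j ≠ c z → ¬ Movable G c z j) :
    ∃ z y₁ y₂, c z ∈ T ∧ c y₁ ∉ A ∧ c y₂ ∉ A ∧ Solo G c z y₁ ∧ Solo G c z y₂ ∧ y₁ ≠ y₂ ∧
      ¬ G.Adj y₁ y₂ := by
  by_contra! hcl
  obtain ⟨W, hW⟩ := hTne
  have hqt := card_compl_lt_card_terminal hdeg hTA hU hUT hW (hTs W hW) hB hA hT hsolo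
  set q := Aᶜ.card with hq
  set t := T.card with ht
  set B := fiber c Aᶜ with hBdef
  have memB : ∀ y, y ∈ B ↔ c y ∉ A := fun y => by rw [hBdef, mem_fiber, mem_compl]
  set N : V → ℕ := fun z => (B.filter fun y => Solo G c z y).card with hN
  have hNle : ∀ z y, c z ∈ T → y ∈ B → Solo G c z y → N z ≤ (nbr G c y Aᶜ).card + 1 := by
    intro z y hz hy hzy
    refine (card_le_card (t := insert y (nbr G c y Aᶜ)) fun x hx => ?_).trans (card_insert_le _ _)
    obtain ⟨hxB, hzx⟩ := mem_filter.1 hx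
    by_cases hxy : x = y
    · exact mem_insert.2 (Or.inl hxy)
    · exact mem_insert_of_mem (mem_nbr.2 ⟨hcl z y x hz ((memB y).1 hy) ((memB x).1 hxB) hzy hzx
        (Ne.symm hxy), mem_compl.2 ((memB x).1 hxB)⟩)
  have hlow : ∀ y ∈ B, (t : ℚ) ≤
      ∑ z ∈ fiber c T, if Solo G c z y then (q : ℚ) / N z else 0 := by
    intro y hy
    have hyA := (memB y).1 hy
    have hn := card_solo_ge hdeg hTA (hA y hyA)
    have hdB := card_nbr_compl_lt (c := c) hdeg (subset_refl A) (hA y hyA)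
    rw [← sum_filter]
    set S := (fiber c T).filter fun z => Solo G c z y with hS
    have hnpos : (0 : ℚ) < S.card := by
      have : 0 < S.card := by omega
      exact_mod_cast this
    have hterm : ∀ z ∈ S, (t : ℚ) / S.card ≤ (q : ℚ) / N z := by
      intro z hz
      obtain ⟨hzT, hzy⟩ := mem_filter.1 hz
      have h1 := hNle z y (mem_fiber.1 hzT) hy hzy
      have h2 : 0 < N z := card_pos.2 ⟨y, mem_filter.2 ⟨hy, hzy⟩⟩
      rw [div_le_div_iff₀ hnpos (by exact_mod_cast h2)]
      have h3 : t * N z ≤ q * S.card := by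
        have h4 : N z ≤ q := by omega
        have h5 : N z + t ≤ S.card + q := by omega
        by_cases h6 : t ≤ S.card
        · calc t * N z ≤ S.card * q := Nat.mul_le_mul h6 h4
            _ = _ := mul_comm _ _
        · zify at h5 h6 hqt ⊢
          nlinarith
      exact_mod_cast h3
    calc (t : ℚ) = ∑ z ∈ S, (t : ℚ) / S.card := by
          rw [sum_const, nsmul_eq_mul]; field_simp
      _ ≤ _ := sum_le_sum hterm
  have hup : ∀ z ∈ fiber c T, (∑ y ∈ B, if Solo G c z y then (q : ℚ) / N z else 0) ≤ q := by
    intro z _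
    rw [← sum_filter, sum_const, nsmul_eq_mul]
    change (N z : ℚ) * (q / N z) ≤ q
    by_cases h : (N z : ℚ) = 0
    · rw [h, zero_mul]; positivity
    · rw [mul_div_cancel₀ _ h]
  have h1 := sum_le_sum hlow
  have h2 := sum_le_sum hup
  rw [sum_comm] at h2
  have h3 := h1.trans h2
  have h4 : (fiber c T).card = t * s := by
    rw [card_fiber_eq_sum, sum_congr rfl hTs, sum_const, smul_eq_mul]
  rw [sum_const, sum_const, hB, h4, nsmul_eq_mul, nsmul_eq_mul] at h3
  have h5 : (q * s + 1) * t ≤ t * s * q := by exact_mod_cast h3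
  nlinarith

/-- If only the class of size `s - 1` were accessible, there would be too few edges leaving it. -/
lemma exists_accessible_ne (hdeg : ∀ x, (univ.filter (G.Adj x)).card < Fintype.card ι)
    {s : ℕ} {A : Finset ι} {a : ι} (ha : a ∈ A) (has : (fiber c {a}).card + 1 = s)
    (hB : (fiber c Aᶜ).card = Aᶜ.card * s + 1)
    (hA : ∀ y, c y ∉ A → ∀ j ∈ A, ¬ Movable G c y j) : ∃ x ∈ A, x ≠ a := by
  by_contra! h
  have hAa : A = {a} := eq_singleton_iff_unique_mem.2 ⟨ha, h⟩
  have hcard := card_add_card_compl A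
  have hA1 : A.card = 1 := by rw [hAa, card_singleton]
  have hlow : ∀ y ∈ fiber c Aᶜ, 1 ≤ ((fiber c {a}).filter fun z => G.Adj y z).card := by
    intro y hy
    obtain ⟨z, hz, hyz⟩ := not_movable_iff.1 (hA y (mem_compl.1 (mem_fiber.1 hy)) a ha)
    exact card_pos.2 ⟨z, mem_filter.2 ⟨mem_fiber.2 (mem_singleton.2 hz), hyz⟩⟩
  have hup : ∀ z ∈ fiber c {a}, ((fiber c Aᶜ).filter fun y => G.Adj y z).card ≤ Aᶜ.card := by
    intro z _
    have h1 := hdeg z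
    have h2 : ((fiber c Aᶜ).filter fun y => G.Adj y z).card ≤ (univ.filter (G.Adj z)).card :=
      card_le_card fun y hy => by simpa [G.adj_comm] using (mem_filter.1 hy).2
    omega
  have h1 := sum_le_sum hlow
  have h2 := sum_le_sum hup
  have h3 := sum_card_bipartiteAbove_eq_sum_card_bipartiteBelow (s := fiber c Aᶜ)
    (t := fiber c {a}) G.Adj
  simp only [bipartiteAbove, bipartiteBelow] at h3
  rw [h3, sum_const, smul_eq_mul, mul_one, hB] at h1
  rw [sum_const, smul_eq_mul] at h2
  have h4 : Aᶜ.card * s + 1 ≤ (fiber c {a}).card * Aᶜ.card := h1.trans h2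
  rw [← has] at h4
  nlinarith

/-- A coloring with one class of size `s - 1`, one of size `s + 1` and all others of size `s` can be
made equitable, provided proper subgraphs admit equitable colorings. -/
lemma exists_equitable_of_nearly (hdeg : ∀ x, (univ.filter (G.Adj x)).card < Fintype.card ι)
    {s : ℕ}
    (sub : ∀ (B : Finset V) (K : Finset ι), B.card < Fintype.card V → B.card = s * K.card →
      (∀ x ∈ B, (B.filter (G.Adj x)).card < K.card) →
      ∃ g : V → ι, (∀ x ∈ B, g x ∈ K) ∧ (∀ x ∈ B, ∀ y ∈ B, G.Adj x y → g x ≠ g y) ∧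
        ∀ i ∈ K, (B.filter fun x => g x = i).card = s)
    (n : ℕ) : ∀ (c : V → ι) (a b : ι), Proper G c →
      (∀ i, (fiber c {i}).card + (if i = a then 1 else 0) = s + (if i = b then 1 else 0)) →
      (univ.filter fun i => ¬ ReflTransGen (Moves G c) i a).card = n →
      ∃ d : V → ι, Proper G d ∧ ∀ i, (fiber d {i}).card = s := by
  induction n using Nat.strong_induction_on with
  | _ n ih =>
  intro c a b hc hcard hn
  by_cases hb : ReflTransGen (Moves G c) b a
  · obtain ⟨d, hd, -, -, -, hds⟩ := exists_shift hc a univ b (mem_univ b)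
      (ReflTransGen.mono (fun i j h => ⟨h, mem_univ i, mem_univ j⟩) _ _ hb)
    refine ⟨d, hd, fun i => ?_⟩
    have h1 := hds i
    have h2 := hcard i
    omega
  set A : Finset ι := univ.filter fun i => ReflTransGen (Moves G c) i a with hAdef
  have memA : ∀ i, i ∈ A ↔ ReflTransGen (Moves G c) i a := fun i => by simp [hAdef]
  have haA : a ∈ A := (memA a).2 .refl
  have hbA : b ∉ A := fun h => hb ((memA b).1 h)
  have hab : a ≠ b := fun h => hbA (h ▸ haA)
  have hA : ∀ y, c y ∉ A → ∀ j ∈ A, ¬ Movable G c y j := fun y hy j hj hm =>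
    hy ((memA _).2 (.head ⟨y, rfl, hm⟩ ((memA j).1 hj)))
  have hsA : ∀ i ∈ A, i ≠ a → (fiber c {i}).card = s := fun i hi hia => by
    have := hcard i
    rwa [if_neg hia, if_neg (fun h : i = b => hbA (h ▸ hi))] at this
  have has : (fiber c {a}).card + 1 = s := by
    have := hcard a
    rwa [if_pos rfl, if_neg hab] at this
  have hB : (fiber c Aᶜ).card = Aᶜ.card * s + 1 := by
    rw [card_fiber_eq_sum]
    have : ∀ i ∈ Aᶜ, (fiber c {i}).card = s + (if i = b then 1 else 0) := fun i hi => by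
      have h := hcard i
      rwa [if_neg (fun h : i = a => (mem_compl.1 hi) (h ▸ haA)), add_zero] at h
    rw [sum_congr rfl this, sum_add_distrib, sum_const, smul_eq_mul,
      sum_ite_eq' Aᶜ b, if_pos (mem_compl.2 hbA)]
  obtain ⟨x, hxA, hxa⟩ := exists_accessible_ne hdeg haA has hB hA
  obtain ⟨U, T, hTne, haT, hUT, hUa, hTa, hterm, hTout⟩ :=
    exists_terminal_family (Moves G c) a ⟨x, hxa, (memA x).1 hxA⟩
  have hTA : T ⊆ A := fun W hW => (memA W).2 (hTa W hW)
  have hrecolor : ∀ y, c y ∉ A → ∃ g : V → ι, (∀ v, c v ∉ A → v ≠ y → g v ∉ A) ∧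
      (∀ u v, c u ∉ A → u ≠ y → c v ∉ A → v ≠ y → G.Adj u v → g u ≠ g v) ∧
      (∀ i, i ∉ A → (univ.filter fun v => c v ∉ A ∧ v ≠ y ∧ g v = i).card = s) := by
    intro y hy
    have memB : ∀ v, v ∈ (fiber c Aᶜ).erase y ↔ c v ∉ A ∧ v ≠ y := fun v => by
      rw [mem_erase, mem_fiber, mem_compl, and_comm]
    have hyB : y ∈ fiber c Aᶜ := mem_fiber.2 (mem_compl.2 hy)
    have hcardB := card_erase_add_one hyB
    obtain ⟨g, hg1, hg2, hg3⟩ := sub ((fiber c Aᶜ).erase y) Aᶜ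
      (by have := card_le_univ (fiber c Aᶜ); omega)
      (by rw [mul_comm]; omega)
      (fun v hv => by
        have h1 := card_nbr_compl_lt (c := c) hdeg (subset_refl A) (hA v ((memB v).1 hv).1)
        have h2 : (((fiber c Aᶜ).erase y).filter (G.Adj v)).card ≤ (nbr G c v Aᶜ).card :=
          card_le_card fun w hw => by
            obtain ⟨h3, h4⟩ := mem_filter.1 hw
            exact mem_nbr.2 ⟨h4, mem_compl.2 ((memB w).1 h3).1⟩
        omega)
    refine ⟨g, fun v hv hvy => mem_compl.1 (hg1 v ((memB v).2 ⟨hv, hvy⟩)),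
      fun u v hu huy hv hvy => hg2 u ((memB u).2 ⟨hu, huy⟩) v ((memB v).2 ⟨hv, hvy⟩),
      fun i hi => ?_⟩
    rw [← hg3 i (mem_compl.2 hi)]
    congr 1
    ext v
    simp only [mem_filter, mem_univ, true_and, memB, and_assoc]
  by_cases hmov : ∃ z y X, c z ∈ T ∧ c y ∉ A ∧ Solo G c z y ∧ X ∈ A ∧ X ≠ c z ∧ Movable G c z X
  · obtain ⟨z, y, X, hzT, hy, hzy, hXA, hX, hzX⟩ := hmov
    have hzA := hTA hzT
    obtain ⟨g, hgA, hg, hgs⟩ := hrecolor y hy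
    obtain ⟨c', hc', hout, hin, hsubX, hcard'⟩ := exists_shift hc a (A.erase (c z)) X
      (mem_erase.2 ⟨hX, hXA⟩)
      (reflTransGen_avoid_mem memA (hterm (c z) hzT X ((memA X).1 hXA) hX))
    have hz' : c' z = c z := hout z (by simp)
    have hmem : ∀ v, c' v ∈ A ↔ c v ∈ A := by
      intro v
      by_cases hv : c v ∈ A.erase (c z)
      · exact ⟨fun _ => (mem_erase.1 hv).2, fun _ => (mem_erase.1 (hin v hv)).2⟩
      · rw [hout v hv]
    have hW : ∀ v, c' v = c z → c v = c z := by
      intro v hv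
      by_cases hvP : c v ∈ A.erase (c z)
      · exact absurd hv (mem_erase.1 (hin v hvP)).1
      · rw [← hv, hout v hvP]
    obtain ⟨d, hd, -, -, -, -, hdA, hdB⟩ := exists_exchange (A := A) (s := s) (z := z) (y := y)
      (X := X) (g := g) hc' (by rwa [hmem]) (by rwa [hmem])
      ⟨hzy.1, fun w hw => hzy.2 w (hW w (hw.trans hz'))⟩ (by rwa [hz'])
      (by simpa only [hmem] using hgA) (by simpa only [hmem] using hg)
      (by simpa only [hmem] using hgs) (fun v _ hv => hzX v (hsubX v hv))
      (fun v hv hvy h => absurd (h ▸ hXA) (hgA v (by rwa [← hmem]) hvy))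
    refine ⟨d, hd, fun i => ?_⟩
    by_cases hi : i ∈ A
    · have h1 := hdA i hi
      have h2 := hcard' i
      have h3 := hcard i
      rw [if_neg (fun h : i = b => hbA (h ▸ hi))] at h3
      omega
    · rw [hdB i hi, if_neg (fun h : i = X => hi (h ▸ hXA)), add_zero]
  · push Not at hmov
    have hsolo : ∀ z y, c z ∈ T → c y ∉ A → Solo G c z y → ∀ j ∈ A, j ≠ c z →
      ¬ Movable G c z j := fun z y hz hy hzy j hj hjz => hmov z y j hz hy hzy hj hjz
    obtain ⟨z, y₁, y₂, hzT, hy₁, hy₂, hzy₁, hzy₂, hne, hadj⟩ := exists_solo_pair hdeg hTA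
      ((memA U).2 hUa) hUT hTne (fun W hW => hsA W (hTA hW) fun h => haT (h ▸ hW)) hB hA
      (fun x hx j hj hjT hjU hm =>
        (hTout (c x) hx j ⟨x, rfl, hm⟩ ((memA j).1 hj)).elim hjT hjU) hsolo
    have hzA := hTA hzT
    have hzmov := hsolo z y₁ hzT hy₁ hzy₁
    obtain ⟨g, hgA, hg, hgs⟩ := hrecolor y₁ hy₁
    obtain ⟨X, hXA, hX⟩ : ∃ X, X ∈ Aᶜ ∧ X ∉ ((nbr G c z Aᶜ).erase y₁).image g := by
      apply exists_mem_notMem_of_card_lt_card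
      have h1 := card_nbr_compl_lt (c := c) hdeg (erase_subset (c z) A) (x := z)
        fun j hj => hzmov j (mem_erase.1 hj).2 (mem_erase.1 hj).1
      have h2 := card_erase_add_one hzA
      have h3 : y₁ ∈ nbr G c z Aᶜ := mem_nbr.2 ⟨hzy₁.1.symm, mem_compl.2 hy₁⟩
      have h4 := card_erase_add_one h3
      have h5 := card_image_le (s := (nbr G c z Aᶜ).erase y₁) (f := g)
      omega
    rw [mem_compl] at hXA
    obtain ⟨d, hd, hdz, hdy, hdvA, hdvB, hdA, hdB⟩ := exists_exchange (g := g) (X := X) hc hzA hy₁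
      hzy₁ (fun h => hXA (h ▸ hzA)) hgA hg hgs (fun v hv h => absurd (h ▸ hv) hXA)
      (fun v hv hvy h hzv => hX (mem_image.2
        ⟨v, mem_erase.2 ⟨hvy, mem_nbr.2 ⟨hzv, mem_compl.2 hv⟩⟩, h⟩))
    obtain ⟨hacc, hacc₂⟩ := accessible_of_exchange memA hzA (fun h => haT (h ▸ hzT)) hXA
      hzy₂ hadj (fun i hi hiz => hterm (c z) hzT i ((memA i).1 hi) hiz) hzmov hgA hdz hdy
      hdvA hdvB
    refine ih _ ?_ d a X hd (fun i => ?_) rfl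
    · rw [← hn]
      refine card_lt_card ((ssubset_iff_of_subset fun i hi => ?_).2 ⟨d y₂, ?_, ?_⟩)
      · simp only [mem_filter, mem_univ, true_and] at hi ⊢
        exact fun h => hi (hacc i ((memA i).2 h))
      · simp only [mem_filter, mem_univ, true_and]
        rw [← memA, hdvB y₂ hne.symm hy₂]
        exact hgA y₂ hy₂ hne.symm
      · simpa using hacc₂
    · by_cases hi : i ∈ A
      · have h1 := hcard i
        rw [hdA i hi, if_neg (fun h : i = X => hXA (h ▸ hi)), add_zero, h1,
          if_neg (fun h : i = b => hbA (h ▸ hi))]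
      · rw [hdB i hi, if_neg (fun h : i = a => hi (h ▸ haA)), add_zero]

end Colorings

/-- The Hajnal–Szemerédi theorem when the number of colors divides the number of vertices. -/
lemma exists_equitable (s n : ℕ) : ∀ (V : Type u) [Fintype V] (ι : Type v) [Fintype ι]
    (G : SimpleGraph V), Fintype.card V = n → Fintype.card V = s * Fintype.card ι →
    (∀ x, (univ.filter (G.Adj x)).card < Fintype.card ι) →
    ∃ d : V → ι, Proper G d ∧ ∀ i, (fiber d {i}).card = s := by
  induction n using Nat.strong_induction_on with
  | _ n ih =>
  intro V _ ι _ G hn hcard hdeg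
  have sub : ∀ (H : SimpleGraph V) (B : Finset V) (K : Finset ι), B.card < Fintype.card V →
      B.card = s * K.card → (∀ x ∈ B, (B.filter (H.Adj x)).card < K.card) →
      ∃ g : V → ι, (∀ x ∈ B, g x ∈ K) ∧ (∀ x ∈ B, ∀ y ∈ B, H.Adj x y → g x ≠ g y) ∧
        ∀ i ∈ K, (B.filter fun x => g x = i).card = s := by
    intro H B K hBV hBK hB
    obtain ⟨d, hd, hds⟩ := ih B.card (hn ▸ hBV) {x // x ∈ B} {i // i ∈ K}
      (H.comap Subtype.val) (Fintype.card_coe B) (by rw [Fintype.card_coe, Fintype.card_coe, hBK])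
      (fun x => by
        rw [Fintype.card_coe]
        refine lt_of_le_of_lt ?_ (hB x x.2)
        refine card_le_card_of_injOn Subtype.val (fun y hy => ?_) Subtype.val_injective.injOn
        simpa using hy)
    obtain ⟨g, hg⟩ : ∃ g : V → ι, ∀ x : {x // x ∈ B}, g x = d x := by
      rcases isEmpty_or_nonempty V with hV | ⟨⟨x⟩⟩
      · exact ⟨fun x => isEmptyElim x, fun x => isEmptyElim (x : V)⟩
      · obtain ⟨i₀⟩ := Fintype.card_pos_iff.1 (lt_of_le_of_lt (Nat.zero_le _) (hdeg x))
        exact ⟨fun x => if h : x ∈ B then d ⟨x, h⟩ else i₀, fun x => by simp⟩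
    refine ⟨g, fun x hx => ?_, fun x hx y hy hxy h => ?_, fun i hi => ?_⟩
    · rw [hg ⟨x, hx⟩]; exact (d ⟨x, hx⟩).2
    · rw [hg ⟨x, hx⟩, hg ⟨y, hy⟩] at h
      exact hd ⟨x, hx⟩ ⟨y, hy⟩ hxy (Subtype.ext h)
    · rw [← hds ⟨i, hi⟩]
      symm
      refine card_bij (fun x _ => x.1) (fun x hx => ?_) (fun _ _ _ _ h => Subtype.ext h)
        fun x hx => ?_
      · refine mem_filter.2 ⟨x.2, ?_⟩
        rw [hg x, mem_singleton.1 (mem_fiber.1 hx)]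
      · obtain ⟨hxB, hxi⟩ := mem_filter.1 hx
        refine ⟨⟨x, hxB⟩, mem_fiber.2 (mem_singleton.2 (Subtype.ext ?_)), rfl⟩
        rw [← hg ⟨x, hxB⟩, hxi]
  have key : ∀ F : Finset V, ∃ d : V → ι,
      (∀ x ∈ F, ∀ y ∈ F, G.Adj x y → d x ≠ d y) ∧ ∀ i, (fiber d {i}).card = s := by
    intro F
    induction F using Finset.induction_on with
    | empty =>
      have e : V ≃ Fin s × ι := Fintype.equivOfCardEq (by simp [hcard])
      refine ⟨fun x => (e x).2, by simp, fun i => ?_⟩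
      refine Eq.trans ?_ (card_fin s)
      refine card_bij' (fun x _ => (e x).1) (fun k _ => e.symm (k, i)) (by simp)
        (by simp [mem_fiber]) (fun x hx => ?_) (by simp)
      have hx' : (e x).2 = i := by simpa [mem_fiber] using hx
      rw [← hx']
      simp
    | insert u F hu ihF =>
      obtain ⟨c, hc, hcs⟩ := ihF
      obtain ⟨H, hH⟩ : ∃ H : SimpleGraph V, ∀ x y, H.Adj x y ↔
          G.Adj x y ∧ x ∈ insert u F ∧ y ∈ insert u F :=
        ⟨{ Adj := fun x y => G.Adj x y ∧ x ∈ insert u F ∧ y ∈ insert u F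
           symm := ⟨fun x y h => ⟨h.1.symm, h.2.2, h.2.1⟩⟩
           loopless := ⟨fun x h => G.loopless.irrefl x h.1⟩ }, fun _ _ => Iff.rfl⟩
      have hHdeg : ∀ x, (univ.filter (H.Adj x)).card < Fintype.card ι := fun x =>
        lt_of_le_of_lt (card_le_card fun y hy => by
          simp only [mem_filter, mem_univ, true_and] at hy ⊢
          exact ((hH _ _).1 hy).1) (hdeg x)
      obtain ⟨j, -, hj⟩ : ∃ j, j ∈ (univ : Finset ι) ∧ j ∉ (univ.filter (H.Adj u)).image c :=
        exists_mem_notMem_of_card_lt_card (card_image_le.trans_lt (hHdeg u))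
      have hmov : ∀ y, c y = j → ¬ H.Adj u y := fun y hy h =>
        hj (mem_image.2 ⟨y, by simpa using h, hy⟩)
      have hproper : Proper H (Function.update c u j) := by
        intro x y hxy
        by_cases hx : x = u
        · subst hx
          rw [Function.update_self, Function.update_of_ne hxy.ne']
          exact fun h => hmov y h.symm hxy
        · by_cases hy : y = u
          · subst hy
            rw [Function.update_self, Function.update_of_ne hxy.ne]
            exact fun h => hmov x h hxy.symm
          · rw [Function.update_of_ne hx, Function.update_of_ne hy]
            obtain ⟨hG, hxF, hyF⟩ := (hH x y).1 hxy
            exact hc x (mem_of_mem_insert_of_ne hxF hx) y (mem_of_mem_insert_of_ne hyF hy) hG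
      obtain ⟨d, hd, hds⟩ := exists_equitable_of_nearly hHdeg (sub H) _
        (Function.update c u j) (c u) j hproper
        (fun i => by rw [card_fiber_update, hcs]) rfl
      exact ⟨d, fun x hx y hy hxy => hd x y ((hH x y).2 ⟨hxy, hx, hy⟩), hds⟩
  obtain ⟨d, hd, hds⟩ := key univ
  exact ⟨d, fun x y => hd x (mem_univ x) y (mem_univ y), hds⟩

end HajnalSzemeredi

/-- **Hajnal–Szemerédi theorem.** Every finite simple graph `G` has an equitable
`k`-coloring whenever `k ≥ Δ(G) + 1`: a proper coloring with `k` colors in which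
the sizes of any two color classes differ by at most 1. -/
theorem hajnal_szemeredi {V : Type*} [Fintype V] [DecidableEq V]
    (G : SimpleGraph V) [DecidableRel G.Adj] (k : ℕ) (hk : G.maxDegree + 1 ≤ k) :
    ∃ c : V → Fin k,
      (∀ u v : V, G.Adj u v → c u ≠ c v) ∧
      ∀ i j : Fin k,
        (Finset.univ.filter fun v => c v = i).card ≤
          (Finset.univ.filter fun v => c v = j).card + 1 := by
  classical
  set n := Fintype.card V with hn
  set p := k - n % k with hp
  have hmod : n % k < k := Nat.mod_lt _ (by omega)
  obtain ⟨d, hd, hds⟩ := HajnalSzemeredi.exists_equitable (n / k + 1) _ (V ⊕ Fin p) (Fin k)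
    (G ⊕g (⊤ : SimpleGraph (Fin p))) rfl
    (by
      have := Nat.div_add_mod n k
      rw [Fintype.card_sum, Fintype.card_fin, Fintype.card_fin, add_mul, mul_comm (n / k)]
      omega)
    (by
      rw [Fintype.card_fin]
      rintro (x | x)
      · have h1 : (Finset.univ.filter ((G ⊕g (⊤ : SimpleGraph (Fin p))).Adj (Sum.inl x))) ⊆
            (G.neighborFinset x).map Function.Embedding.inl := by
          rintro (y | y) hy
          · simpa using hy
          · simp at hy
        have h2 := Finset.card_le_card h1
        rw [Finset.card_map, G.card_neighborFinset_eq_degree] at h2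
        have := G.degree_le_maxDegree x
        omega
      · have h1 : (Finset.univ.filter ((G ⊕g (⊤ : SimpleGraph (Fin p))).Adj (Sum.inr x))) ⊆
            (Finset.univ.erase x).map Function.Embedding.inr := by
          rintro (y | y) hy
          · simp at hy
          · simpa [eq_comm] using hy
        have h2 := Finset.card_le_card h1
        rw [Finset.card_map, Finset.card_erase_of_mem (Finset.mem_univ x), Finset.card_univ,
          Fintype.card_fin] at h2
        have := x.pos
        omega)
  have hcount : ∀ i, (Finset.univ.filter fun v => d (Sum.inl v) = i).card +
      (Finset.univ.filter fun v => d (Sum.inr v) = i).card = n / k + 1 := by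
    intro i
    rw [← hds i, ← Finset.card_disjSum]
    congr 1
    ext (x | x) <;> simp [HajnalSzemeredi.mem_fiber]
  have hone : ∀ i, (Finset.univ.filter fun v => d (Sum.inr v) = i).card ≤ 1 := by
    intro i
    refine Finset.card_le_one.2 fun x hx y hy => ?_
    simp only [Finset.mem_filter, Finset.mem_univ, true_and] at hx hy
    by_contra hxy
    exact hd (Sum.inr x) (Sum.inr y) (by simpa using hxy) (hx.trans hy.symm)
  refine ⟨fun v => d (Sum.inl v), fun u v huv => hd _ _ (by simpa using huv), fun i j => ?_⟩
  have h1 := hcount i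
  have h2 := hcount j
  have h3 := hone j
  dsimp only
  omega
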